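/- arXiv:math/0604195 — 8 statements merged into one kernel-verified Lean document; each statement's English description precedes it below -/
import Mathlib

section
/- Fix arbitrary values λ'_1 and μ'_{j,k} (2 ≤ j < k ≤ 6) in K, set η'_1 = η'_2 = η'_3 = η'_4 = η'_5 = η'_6 = 1, and define μ'_{1,2} := μ'_{2,3} + μ'_{2,4} + μ'_{2,5} + μ'_{2,6}; μ'_{1,3} := μ'_{2,3} − μ'_{3,4} − μ'_{3,5} − μ'_{3,6}; μ'_{1,4} := −μ'_{2,4} − μ'_{3,4} + μ'_{4,5} − μ'_{4,6}; μ'_{1,5} := −μ'_{2,5} − μ'_{3,5} − μ'_{4,5} + μ'_{5,6}; μ'_{1,6} := −μ'_{2,6} − μ'_{3,6} + μ'_{4,6} − μ'_{5,6}; λ'_2 := μ'_{3,4}μ'_{5,6} + μ'_{3,5}μ'_{4,6} + μ'_{3,6}μ'_{4,5} + λ'_1; λ'_3 := −μ'_{2,4}μ'_{5,6} − μ'_{2,5}μ'_{4,6} − μ'_{2,6}μ'_{4,5} + λ'_1; λ'_4 := −μ'_{2,3}μ'_{5,6} + μ'_{2,5}μ'_{3,6} − μ'_{2,6}μ'_{3,5}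 − λ'_1; λ'_5 := −μ'_{2,3}μ'_{4,6} − μ'_{2,4}μ'_{3,6} + μ'_{2,6}μ'_{3,4} − λ'_1; λ'_6 := −μ'_{2,3}μ'_{4,5} + μ'_{2,4}μ'_{3,5} − μ'_{2,5}μ'_{3,4} − λ'_1. Then all 27 partial derivatives of the cubic form F vanish at the resulting point of K^27; that is, the point lies on H_6. -/
open MvPolynomial Matrix

/-- Index pairs `(i,j)` with `i < j` for the coordinates `μ'_{i,j}`. -/
abbrev P6 := {p : Fin 6 × Fin 6 // p.1 < p.2}

/-- The 27 coordinates: `η'_1,…,η'_6`, `μ'_{i,j}` (`i<j`), `λ'_1,…,λ'_6` (0-based indices). -/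
abbrev I27 := Fin 6 ⊕ P6 ⊕ Fin 6

def Ie (i : Fin 6) : I27 := Sum.inl i
def Im (i j : Fin 6) (h : i < j := by decide) : I27 := Sum.inr (Sum.inl ⟨(i, j), h⟩)
def Il (i : Fin 6) : I27 := Sum.inr (Sum.inr i)

variable (K : Type) [Field K]

noncomputable def M1 : Matrix (Fin 3) (Fin 3) (MvPolynomial I27 K) :=
  !![X (Ie 0), X (Il 0), X (Im 1 2);
     X (Ie 1), X (Il 1), X (Im 0 2);
     X (Ie 2), X (Il 2), X (Im 0 1)]

noncomputable def M2 : Matrix (Fin 3) (Fin 3) (MvPolynomial I27 K) :=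
  !![X (Il 3), X (Il 4), X (Il 5);
     X (Ie 3), X (Ie 4), X (Ie 5);
     X (Im 4 5), X (Im 3 5), X (Im 3 4)]

noncomputable def M3 : Matrix (Fin 3) (Fin 3) (MvPolynomial I27 K) :=
  !![X (Im 0 3), X (Im 1 3), X (Im 2 3);
     X (Im 0 4), X (Im 1 4), X (Im 2 4);
     X (Im 0 5), X (Im 1 5), X (Im 2 5)]

/-- The cubic form `F = det M₁ + det M₂ + det M₃ − tr(M₁M₂M₃)`. -/
noncomputable def Fcubic : MvPolynomial I27 K :=
  (M1 K).det + (M2 K).det + (M3 K).det - (M1 K * M2 K * M3 K).trace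

/-- Membership in the affine cone `H₆` over `G₆/P₆`: all 27 partial derivatives
of `F` vanish at the point `x`. -/
def H6mem (x : I27 → K) : Prop := ∀ v : I27, eval x (pderiv v (Fcubic K)) = 0

theorem statement0 [IsAlgClosed K] [CharZero K] (x : I27 → K)
    (hη : ∀ i : Fin 6, x (Ie i) = 1)
    (h12 : x (Im 0 1) = x (Im 1 2) + x (Im 1 3) + x (Im 1 4) + x (Im 1 5))
    (h13 : x (Im 0 2) = x (Im 1 2) - x (Im 2 3) - x (Im 2 4) - x (Im 2 5))
    (h14 : x (Im 0 3) = -x (Im 1 3) - x (Im 2 3) + x (Im 3 4) - x (Im 3 5))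
    (h15 : x (Im 0 4) = -x (Im 1 4) - x (Im 2 4) - x (Im 3 4) + x (Im 4 5))
    (h16 : x (Im 0 5) = -x (Im 1 5) - x (Im 2 5) + x (Im 3 5) - x (Im 4 5))
    (hl2 : x (Il 1) = x (Im 2 3) * x (Im 4 5) + x (Im 2 4) * x (Im 3 5)
      + x (Im 2 5) * x (Im 3 4) + x (Il 0))
    (hl3 : x (Il 2) = -(x (Im 1 3) * x (Im 4 5)) - x (Im 1 4) * x (Im 3 5)
      - x (Im 1 5) * x (Im 3 4) + x (Il 0))
    (hl4 : x (Il 3) = -(x (Im 1 2) * x (Im 4 5)) + x (Im 1 4) * x (Im 2 5)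
      - x (Im 1 5) * x (Im 2 4) - x (Il 0))
    (hl5 : x (Il 4) = -(x (Im 1 2) * x (Im 3 5)) - x (Im 1 3) * x (Im 2 5)
      + x (Im 1 5) * x (Im 2 3) - x (Il 0))
    (hl6 : x (Il 5) = -(x (Im 1 2) * x (Im 3 4)) + x (Im 1 3) * x (Im 2 4)
      - x (Im 1 4) * x (Im 2 3) - x (Il 0)) :
    H6mem K x := by
  intro v
  -- The derivatives `eval x (pderiv v (X u))` stay symbolic, so the 27 cases are treated at once.
  simp only [Fcubic, M1, M2, M3, det_fin_three, trace_fin_three, mul_apply, Fin.sum_univ_three,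
    of_apply, cons_val, map_add, map_sub, Derivation.leibniz, smul_eq_mul, map_mul, eval_X]
  simp only [hl2, hl3, hl4, hl5, hl6, h12, h13, h14, h15, h16, hη]
  ring
end

section
/- For t_0, t_1, …, t_6 ∈ K^× and x ∈ K^27, let t·x denote the point obtained from x by replacing η'_i by t_i·η'_i, μ'_{i,j} by t_0·t_i^{−1}·t_j^{−1}·μ'_{i,j}, and λ'_i by t_0^2·t_i·(t_1 t_2 t_3 t_4 t_5 t_6)^{−1}·λ'_i. Then F(t·x) = t_0^3·(t_1 t_2 t_3 t_4 t_5 t_6)^{−1}·F(x) for all x; consequently, this action of (K^×)^7 preserves H_6: if all 27 partial derivatives of F vanish at x, then they all vanish at t·x. -/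
open MvPolynomial Matrix

variable (K : Type) [Field K]

/-- The action of `(K^×)^7` on `K^27`: `η'_i ↦ t_i η'_i`,
`μ'_{i,j} ↦ t_0 t_i⁻¹ t_j⁻¹ μ'_{i,j}`, `λ'_i ↦ t_0² t_i (t_1⋯t_6)⁻¹ λ'_i`. -/
noncomputable def torusAct (t0 : K) (t : Fin 6 → K) (x : I27 → K) : I27 → K := fun v =>
  match v with
  | Sum.inl i => t i * x (Sum.inl i)
  | Sum.inr (Sum.inl p) => t0 * (t p.1.1)⁻¹ * (t p.1.2)⁻¹ * x (Sum.inr (Sum.inl p))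
  | Sum.inr (Sum.inr i) => t0 ^ 2 * t i * (∏ j, t j)⁻¹ * x (Sum.inr (Sum.inr i))

/-- Chain rule for a diagonal linear substitution of the variables. -/
theorem pderiv_bind₁_C_mul_X {σ R : Type*} [CommSemiring R] (w : σ → R) (v : σ)
    (p : MvPolynomial σ R) :
    pderiv v (bind₁ (fun i => C (w i) * X i) p) =
      C (w v) * bind₁ (fun i => C (w i) * X i) (pderiv v p) := by
  classical
  induction p using MvPolynomial.induction_on with
  | C a => simp
  | add p q hp hq => simp only [map_add, hp, hq, mul_add]
  | mul_X p i hp =>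
    simp only [map_mul, bind₁_X_right, Derivation.leibniz, hp, smul_eq_mul, map_add, pderiv_X,
      pderiv_C]
    by_cases h : i = v
    · subst h
      simp only [Pi.single_eq_same, map_one]
      ring
    · simp only [Pi.single_eq_of_ne h, map_zero]
      ring

/-- The partial derivatives of a semi-invariant of a diagonal substitution are semi-invariants. -/
theorem mul_eval_pderiv_of_eval_mul {σ R : Type*} [CommRing R] [IsDomain R] [Infinite R]
    {w : σ → R} {c : R} {p : MvPolynomial σ R}
    (h : ∀ y : σ → R, eval (fun i => w i * y i) p = c * eval y p) (x : σ → R) (v : σ) :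
    w v * eval (fun i => w i * x i) (pderiv v p) = c * eval x (pderiv v p) := by
  have eval_bind (y : σ → R) (q : MvPolynomial σ R) :
      eval y (bind₁ (fun i => C (w i) * X i) q) = eval (fun i => w i * y i) q := by
    refine (eval₂Hom_bind₁ (RingHom.id R) y _ q).trans ?_
    change eval (fun i => eval y (C (w i) * X i)) q = _
    simp only [map_mul, eval_C, eval_X]
  have hp : bind₁ (fun i => C (w i) * X i) p = C c * p :=
    MvPolynomial.funext fun y => by simp [eval_bind, h]
  have := congrArg (fun q => eval x (pderiv v q)) hp
  simpa [pderiv_bind₁_C_mul_X, eval_bind, pderiv_C_mul, smul_eval] using this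

/-- The character by which the torus acts on the coordinate `v`. -/
noncomputable def torusWeight (t0 : K) (t : Fin 6 → K) : I27 → K
  | Sum.inl i => t i
  | Sum.inr (Sum.inl p) => t0 * (t p.1.1)⁻¹ * (t p.1.2)⁻¹
  | Sum.inr (Sum.inr i) => t0 ^ 2 * t i * (∏ j, t j)⁻¹

theorem torusAct_eq_torusWeight_mul (t0 : K) (t : Fin 6 → K) (x : I27 → K) :
    torusAct K t0 t x = fun v => torusWeight K t0 t v * x v := by
  funext v
  rcases v with i | p | i <;> rfl

theorem torusWeight_ne_zero {t0 : K} {t : Fin 6 → K} (ht0 : t0 ≠ 0) (ht : ∀ i, t i ≠ 0)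
    (v : I27) : torusWeight K t0 t v ≠ 0 := by
  rcases v with i | p | i <;> simp [torusWeight, ht0, ht, Finset.prod_ne_zero_iff]

theorem eval_torusAct_Fcubic {t0 : K} {t : Fin 6 → K} (ht : ∀ i, t i ≠ 0) (x : I27 → K) :
    eval (torusAct K t0 t x) (Fcubic K) = t0 ^ 3 * (∏ j, t j)⁻¹ * eval x (Fcubic K) := by
  have h0 := ht 0
  have h1 := ht 1
  have h2 := ht 2
  have h3 := ht 3
  have h4 := ht 4
  have h5 := ht 5
  simp only [Fcubic, M1, M2, M3, det_fin_three, trace_fin_three, Matrix.mul_apply,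
    Fin.sum_univ_three, of_apply, cons_val', cons_val_zero, cons_val_one, cons_val, map_add,
    map_sub, map_mul, eval_X, torusAct, Ie, Im, Il, Fin.prod_univ_six]
  field_simp

theorem statement1 [IsAlgClosed K] [CharZero K]
    (t0 : K) (t : Fin 6 → K) (ht0 : t0 ≠ 0) (ht : ∀ i, t i ≠ 0) (x : I27 → K) :
    eval (torusAct K t0 t x) (Fcubic K) = t0 ^ 3 * (∏ j, t j)⁻¹ * eval x (Fcubic K)
      ∧ (H6mem K x → H6mem K (torusAct K t0 t x)) := by
  refine ⟨eval_torusAct_Fcubic K ht x, fun hx v => ?_⟩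
  have h := mul_eval_pderiv_of_eval_mul (w := torusWeight K t0 t) (p := Fcubic K)
    (fun y => torusAct_eq_torusWeight_mul K t0 t y ▸ eval_torusAct_Fcubic K ht y) x v
  rw [hx v, mul_zero, ← torusAct_eq_torusWeight_mul] at h
  exact (mul_eq_zero.mp h).resolve_left (torusWeight_ne_zero K ht0 ht v)
end

section
/- Let x ∈ K^27 be a point at which the coordinates η'_1, …, η'_6 are all nonzero. If the ten partial derivatives ∂F/∂μ'_{1,i} and ∂F/∂λ'_i for i = 2, …, 6 all vanish at x, then all 27 partial derivatives of F vanish at x, i.e., x lies on H_6. -/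
open MvPolynomial Matrix

variable (K : Type) [Field K]

theorem eval_pderiv_Ie_Fcubic (x : I27 → K) (i : Fin 6) :
    eval x (pderiv (Ie i) (Fcubic K)) =
      ![x (Il 1) * x (Im 0 1) - x (Il 2) * x (Im 0 2) - x (Il 3) * x (Im 0 3)
          - x (Il 4) * x (Im 0 4) - x (Il 5) * x (Im 0 5),
        x (Il 2) * x (Im 1 2) - x (Il 0) * x (Im 0 1) - x (Il 3) * x (Im 1 3)
          - x (Il 4) * x (Im 1 4) - x (Il 5) * x (Im 1 5),
        x (Il 0) * x (Im 0 2) - x (Il 1) * x (Im 1 2) - x (Il 3) * x (Im 2 3)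
          - x (Il 4) * x (Im 2 4) - x (Il 5) * x (Im 2 5),
        x (Il 5) * x (Im 3 5) - x (Il 4) * x (Im 3 4) - x (Il 0) * x (Im 0 3)
          - x (Il 1) * x (Im 1 3) - x (Il 2) * x (Im 2 3),
        x (Il 3) * x (Im 3 4) - x (Il 5) * x (Im 4 5) - x (Il 0) * x (Im 0 4)
          - x (Il 1) * x (Im 1 4) - x (Il 2) * x (Im 2 4),
        x (Il 4) * x (Im 4 5) - x (Il 3) * x (Im 3 5) - x (Il 0) * x (Im 0 5)
          - x (Il 1) * x (Im 1 5) - x (Il 2) * x (Im 2 5)] i := by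
  fin_cases i <;>
    simp [Fcubic, M1, M2, M3, det_fin_three, trace_fin_three, pderiv_X, Ie, Im, Il] <;>
    ring

theorem eval_pderiv_Il_Fcubic (x : I27 → K) (i : Fin 6) :
    eval x (pderiv (Il i) (Fcubic K)) =
      ![x (Ie 2) * x (Im 0 2) - x (Ie 1) * x (Im 0 1) - x (Ie 3) * x (Im 0 3)
          - x (Ie 4) * x (Im 0 4) - x (Ie 5) * x (Im 0 5),
        x (Ie 0) * x (Im 0 1) - x (Ie 2) * x (Im 1 2) - x (Ie 3) * x (Im 1 3)
          - x (Ie 4) * x (Im 1 4) - x (Ie 5) * x (Im 1 5),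
        x (Ie 1) * x (Im 1 2) - x (Ie 0) * x (Im 0 2) - x (Ie 3) * x (Im 2 3)
          - x (Ie 4) * x (Im 2 4) - x (Ie 5) * x (Im 2 5),
        x (Ie 4) * x (Im 3 4) - x (Ie 5) * x (Im 3 5) - x (Ie 0) * x (Im 0 3)
          - x (Ie 1) * x (Im 1 3) - x (Ie 2) * x (Im 2 3),
        x (Ie 5) * x (Im 4 5) - x (Ie 3) * x (Im 3 4) - x (Ie 0) * x (Im 0 4)
          - x (Ie 1) * x (Im 1 4) - x (Ie 2) * x (Im 2 4),
        x (Ie 3) * x (Im 3 5) - x (Ie 4) * x (Im 4 5) - x (Ie 0) * x (Im 0 5)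
          - x (Ie 1) * x (Im 1 5) - x (Ie 2) * x (Im 2 5)] i := by
  fin_cases i <;>
    simp [Fcubic, M1, M2, M3, det_fin_three, trace_fin_three, pderiv_X, Ie, Im, Il] <;>
    ring

set_option maxHeartbeats 2000000 in
theorem eval_pderiv_Im_Fcubic (x : I27 → K) (i j : Fin 6) (hij : i < j) :
    eval x (pderiv (Im i j hij) (Fcubic K)) =
      (![![0,
          x (Ie 0) * x (Il 1) - x (Ie 1) * x (Il 0) - x (Im 2 3) * x (Im 4 5)
            - x (Im 2 4) * x (Im 3 5) - x (Im 2 5) * x (Im 3 4),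
          x (Ie 2) * x (Il 0) - x (Ie 0) * x (Il 2) - x (Im 1 3) * x (Im 4 5)
            - x (Im 1 4) * x (Im 3 5) - x (Im 1 5) * x (Im 3 4),
          x (Im 1 4) * x (Im 2 5) - x (Im 1 5) * x (Im 2 4)
            - x (Ie 0) * x (Il 3) - x (Ie 3) * x (Il 0) - x (Im 1 2) * x (Im 4 5),
          x (Im 1 5) * x (Im 2 3) - x (Im 1 3) * x (Im 2 5)
            - x (Ie 0) * x (Il 4) - x (Ie 4) * x (Il 0) - x (Im 1 2) * x (Im 3 5),
          x (Im 1 3) * x (Im 2 4) - x (Im 1 4) * x (Im 2 3)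
            - x (Ie 0) * x (Il 5) - x (Ie 5) * x (Il 0) - x (Im 1 2) * x (Im 3 4)],
        ![0, 0,
          x (Ie 1) * x (Il 2) - x (Ie 2) * x (Il 1) - x (Im 0 3) * x (Im 4 5)
            - x (Im 0 4) * x (Im 3 5) - x (Im 0 5) * x (Im 3 4),
          x (Im 0 5) * x (Im 2 4) - x (Im 0 4) * x (Im 2 5)
            - x (Ie 1) * x (Il 3) - x (Ie 3) * x (Il 1) - x (Im 0 2) * x (Im 4 5),
          x (Im 0 3) * x (Im 2 5) - x (Im 0 5) * x (Im 2 3)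
            - x (Ie 1) * x (Il 4) - x (Ie 4) * x (Il 1) - x (Im 0 2) * x (Im 3 5),
          x (Im 0 4) * x (Im 2 3) - x (Im 0 3) * x (Im 2 4)
            - x (Ie 1) * x (Il 5) - x (Ie 5) * x (Il 1) - x (Im 0 2) * x (Im 3 4)],
        ![0, 0, 0,
          x (Im 0 4) * x (Im 1 5) - x (Im 0 5) * x (Im 1 4)
            - x (Ie 2) * x (Il 3) - x (Ie 3) * x (Il 2) - x (Im 0 1) * x (Im 4 5),
          x (Im 0 5) * x (Im 1 3) - x (Im 0 3) * x (Im 1 5)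
            - x (Ie 2) * x (Il 4) - x (Ie 4) * x (Il 2) - x (Im 0 1) * x (Im 3 5),
          x (Im 0 3) * x (Im 1 4) - x (Im 0 4) * x (Im 1 3)
            - x (Ie 2) * x (Il 5) - x (Ie 5) * x (Il 2) - x (Im 0 1) * x (Im 3 4)],
        ![0, 0, 0, 0,
          x (Ie 4) * x (Il 3) - x (Ie 3) * x (Il 4) - x (Im 0 5) * x (Im 1 2)
            - x (Im 0 2) * x (Im 1 5) - x (Im 0 1) * x (Im 2 5),
          x (Ie 3) * x (Il 5) - x (Ie 5) * x (Il 3) - x (Im 0 4) * x (Im 1 2)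
            - x (Im 0 2) * x (Im 1 4) - x (Im 0 1) * x (Im 2 4)],
        ![0, 0, 0, 0, 0,
          x (Ie 5) * x (Il 4) - x (Ie 4) * x (Il 5) - x (Im 0 3) * x (Im 1 2)
            - x (Im 0 2) * x (Im 1 3) - x (Im 0 1) * x (Im 2 3)],
        ![0, 0, 0, 0, 0, 0]] : Fin 6 → Fin 6 → K) i j := by
  fin_cases i <;> fin_cases j <;> first
    | exact absurd hij (by decide)
    | simp [Fcubic, M1, M2, M3, det_fin_three, trace_fin_three, pderiv_X, Ie, Im, Il]
      ring

theorem statement2 [IsAlgClosed K] [CharZero K] (x : I27 → K)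
    (hη : ∀ i : Fin 6, x (Ie i) ≠ 0)
    (h : ∀ j : Fin 6, ∀ hj : (0 : Fin 6) < j,
      eval x (pderiv (Im 0 j hj) (Fcubic K)) = 0 ∧ eval x (pderiv (Il j) (Fcubic K)) = 0) :
    H6mem K x := by
  have hm01 : x (Ie 0) * x (Il 1) - x (Ie 1) * x (Il 0) - x (Im 2 3) * x (Im 4 5)
        - x (Im 2 4) * x (Im 3 5) - x (Im 2 5) * x (Im 3 4) = 0 := by
    simpa [eval_pderiv_Im_Fcubic] using (h 1 (by decide)).1
  have hm02 : x (Ie 2) * x (Il 0) - x (Ie 0) * x (Il 2) - x (Im 1 3) * x (Im 4 5)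
        - x (Im 1 4) * x (Im 3 5) - x (Im 1 5) * x (Im 3 4) = 0 := by
    simpa [eval_pderiv_Im_Fcubic] using (h 2 (by decide)).1
  have hm03 : x (Im 1 4) * x (Im 2 5) - x (Im 1 5) * x (Im 2 4) - x (Ie 0) * x (Il 3)
        - x (Ie 3) * x (Il 0) - x (Im 1 2) * x (Im 4 5) = 0 := by
    simpa [eval_pderiv_Im_Fcubic] using (h 3 (by decide)).1
  have hm04 : x (Im 1 5) * x (Im 2 3) - x (Im 1 3) * x (Im 2 5) - x (Ie 0) * x (Il 4)
        - x (Ie 4) * x (Il 0) - x (Im 1 2) * x (Im 3 5) = 0 := by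
    simpa [eval_pderiv_Im_Fcubic] using (h 4 (by decide)).1
  have hm05 : x (Im 1 3) * x (Im 2 4) - x (Im 1 4) * x (Im 2 3) - x (Ie 0) * x (Il 5)
        - x (Ie 5) * x (Il 0) - x (Im 1 2) * x (Im 3 4) = 0 := by
    simpa [eval_pderiv_Im_Fcubic] using (h 5 (by decide)).1
  have hl1 : x (Ie 0) * x (Im 0 1) - x (Ie 2) * x (Im 1 2) - x (Ie 3) * x (Im 1 3)
        - x (Ie 4) * x (Im 1 4) - x (Ie 5) * x (Im 1 5) = 0 := by
    simpa [eval_pderiv_Il_Fcubic] using (h 1 (by decide)).2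
  have hl2 : x (Ie 1) * x (Im 1 2) - x (Ie 0) * x (Im 0 2) - x (Ie 3) * x (Im 2 3)
        - x (Ie 4) * x (Im 2 4) - x (Ie 5) * x (Im 2 5) = 0 := by
    simpa [eval_pderiv_Il_Fcubic] using (h 2 (by decide)).2
  have hl3 : x (Ie 4) * x (Im 3 4) - x (Ie 5) * x (Im 3 5) - x (Ie 0) * x (Im 0 3)
        - x (Ie 1) * x (Im 1 3) - x (Ie 2) * x (Im 2 3) = 0 := by
    simpa [eval_pderiv_Il_Fcubic] using (h 3 (by decide)).2
  have hl4 : x (Ie 5) * x (Im 4 5) - x (Ie 3) * x (Im 3 4) - x (Ie 0) * x (Im 0 4)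
        - x (Ie 1) * x (Im 1 4) - x (Ie 2) * x (Im 2 4) = 0 := by
    simpa [eval_pderiv_Il_Fcubic] using (h 4 (by decide)).2
  have hl5 : x (Ie 3) * x (Im 3 5) - x (Ie 4) * x (Im 4 5) - x (Ie 0) * x (Im 0 5)
        - x (Ie 1) * x (Im 1 5) - x (Ie 2) * x (Im 2 5) = 0 := by
    simpa [eval_pderiv_Il_Fcubic] using (h 5 (by decide)).2
  have hl0 : x (Ie 2) * x (Im 0 2) - x (Ie 1) * x (Im 0 1) - x (Ie 3) * x (Im 0 3)
        - x (Ie 4) * x (Im 0 4) - x (Ie 5) * x (Im 0 5) = 0 := by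
    refine (mul_eq_zero_iff_left (hη 0)).mp ?_
    linear_combination x (Ie 3) * hl3 + x (Ie 4) * hl4 + x (Ie 5) * hl5 - x (Ie 1) * hl1
      - x (Ie 2) * hl2
  have hm12 : x (Ie 1) * x (Il 2) - x (Ie 2) * x (Il 1) - x (Im 0 3) * x (Im 4 5)
        - x (Im 0 4) * x (Im 3 5) - x (Im 0 5) * x (Im 3 4) = 0 := by
    refine (mul_eq_zero_iff_left (hη 0)).mp ?_
    linear_combination x (Im 4 5) * hl3 + x (Im 3 5) * hl4 + x (Im 3 4) * hl5 - x (Ie 2) * hm01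
      - x (Ie 1) * hm02
  have hm13 : x (Im 0 5) * x (Im 2 4) - x (Im 0 4) * x (Im 2 5) - x (Ie 1) * x (Il 3)
        - x (Ie 3) * x (Il 1) - x (Im 0 2) * x (Im 4 5) = 0 := by
    refine (mul_eq_zero_iff_left (hη 0)).mp ?_
    linear_combination x (Im 4 5) * hl2 + x (Im 2 5) * hl4 + x (Ie 1) * hm03 - x (Im 2 4) * hl5
      - x (Ie 3) * hm01
  have hm14 : x (Im 0 3) * x (Im 2 5) - x (Im 0 5) * x (Im 2 3) - x (Ie 1) * x (Il 4)
        - x (Ie 4) * x (Il 1) - x (Im 0 2) * x (Im 3 5) = 0 := by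
    refine (mul_eq_zero_iff_left (hη 0)).mp ?_
    linear_combination x (Im 3 5) * hl2 + x (Im 2 3) * hl5 + x (Ie 1) * hm04 - x (Im 2 5) * hl3
      - x (Ie 4) * hm01
  have hm15 : x (Im 0 4) * x (Im 2 3) - x (Im 0 3) * x (Im 2 4) - x (Ie 1) * x (Il 5)
        - x (Ie 5) * x (Il 1) - x (Im 0 2) * x (Im 3 4) = 0 := by
    refine (mul_eq_zero_iff_left (hη 0)).mp ?_
    linear_combination x (Im 3 4) * hl2 + x (Im 2 4) * hl3 + x (Ie 1) * hm05 - x (Im 2 3) * hl4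
      - x (Ie 5) * hm01
  have hm23 : x (Im 0 4) * x (Im 1 5) - x (Im 0 5) * x (Im 1 4) - x (Ie 2) * x (Il 3)
        - x (Ie 3) * x (Il 2) - x (Im 0 1) * x (Im 4 5) = 0 := by
    refine (mul_eq_zero_iff_left (hη 0)).mp ?_
    linear_combination x (Im 1 4) * hl5 + x (Ie 3) * hm02 + x (Ie 2) * hm03 - x (Im 4 5) * hl1
      - x (Im 1 5) * hl4
  have hm24 : x (Im 0 5) * x (Im 1 3) - x (Im 0 3) * x (Im 1 5) - x (Ie 2) * x (Il 4)
        - x (Ie 4) * x (Il 2) - x (Im 0 1) * x (Im 3 5) = 0 := by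
    refine (mul_eq_zero_iff_left (hη 0)).mp ?_
    linear_combination x (Im 1 5) * hl3 + x (Ie 4) * hm02 + x (Ie 2) * hm04 - x (Im 3 5) * hl1
      - x (Im 1 3) * hl5
  have hm25 : x (Im 0 3) * x (Im 1 4) - x (Im 0 4) * x (Im 1 3) - x (Ie 2) * x (Il 5)
        - x (Ie 5) * x (Il 2) - x (Im 0 1) * x (Im 3 4) = 0 := by
    refine (mul_eq_zero_iff_left (hη 0)).mp ?_
    linear_combination x (Im 1 3) * hl4 + x (Ie 5) * hm02 + x (Ie 2) * hm05 - x (Im 3 4) * hl1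
      - x (Im 1 4) * hl3
  have hm34 : x (Ie 4) * x (Il 3) - x (Ie 3) * x (Il 4) - x (Im 0 5) * x (Im 1 2)
        - x (Im 0 2) * x (Im 1 5) - x (Im 0 1) * x (Im 2 5) = 0 := by
    refine (mul_eq_zero_iff_left (hη 0)).mp ?_
    linear_combination x (Im 1 5) * hl2 + x (Im 1 2) * hl5 + x (Ie 3) * hm04 - x (Im 2 5) * hl1
      - x (Ie 4) * hm03
  have hm35 : x (Ie 3) * x (Il 5) - x (Ie 5) * x (Il 3) - x (Im 0 4) * x (Im 1 2)
        - x (Im 0 2) * x (Im 1 4) - x (Im 0 1) * x (Im 2 4) = 0 := by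
    refine (mul_eq_zero_iff_left (hη 0)).mp ?_
    linear_combination x (Im 1 4) * hl2 + x (Im 1 2) * hl4 + x (Ie 5) * hm03 - x (Im 2 4) * hl1
      - x (Ie 3) * hm05
  have hm45 : x (Ie 5) * x (Il 4) - x (Ie 4) * x (Il 5) - x (Im 0 3) * x (Im 1 2)
        - x (Im 0 2) * x (Im 1 3) - x (Im 0 1) * x (Im 2 3) = 0 := by
    refine (mul_eq_zero_iff_left (hη 0)).mp ?_
    linear_combination x (Im 1 3) * hl2 + x (Im 1 2) * hl3 + x (Ie 4) * hm05 - x (Im 2 3) * hl1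
      - x (Ie 5) * hm04
  have he1 : x (Il 2) * x (Im 1 2) - x (Il 0) * x (Im 0 1) - x (Il 3) * x (Im 1 3)
        - x (Il 4) * x (Im 1 4) - x (Il 5) * x (Im 1 5) = 0 := by
    refine (mul_eq_zero_iff_left (hη 0)).mp ?_
    linear_combination x (Im 1 3) * hm03 + x (Im 1 4) * hm04 + x (Im 1 5) * hm05 - x (Il 0) * hl1
      - x (Im 1 2) * hm02
  have he2 : x (Il 0) * x (Im 0 2) - x (Il 1) * x (Im 1 2) - x (Il 3) * x (Im 2 3)
        - x (Il 4) * x (Im 2 4) - x (Il 5) * x (Im 2 5) = 0 := by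
    refine (mul_eq_zero_iff_left (hη 0)).mp ?_
    linear_combination x (Im 2 3) * hm03 + x (Im 2 4) * hm04 + x (Im 2 5) * hm05 - x (Il 0) * hl2
      - x (Im 1 2) * hm01
  have he3 : x (Il 5) * x (Im 3 5) - x (Il 4) * x (Im 3 4) - x (Il 0) * x (Im 0 3)
        - x (Il 1) * x (Im 1 3) - x (Il 2) * x (Im 2 3) = 0 := by
    refine (mul_eq_zero_iff_left (hη 0)).mp ?_
    linear_combination x (Il 0) * hl3 + x (Im 2 3) * hm02 + x (Im 3 4) * hm04 - x (Im 1 3) * hm01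
      - x (Im 3 5) * hm05
  have he4 : x (Il 3) * x (Im 3 4) - x (Il 5) * x (Im 4 5) - x (Il 0) * x (Im 0 4)
        - x (Il 1) * x (Im 1 4) - x (Il 2) * x (Im 2 4) = 0 := by
    refine (mul_eq_zero_iff_left (hη 0)).mp ?_
    linear_combination x (Il 0) * hl4 + x (Im 2 4) * hm02 + x (Im 4 5) * hm05 - x (Im 1 4) * hm01
      - x (Im 3 4) * hm03
  have he5 : x (Il 4) * x (Im 4 5) - x (Il 3) * x (Im 3 5) - x (Il 0) * x (Im 0 5)
        - x (Il 1) * x (Im 1 5) - x (Il 2) * x (Im 2 5) = 0 := by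
    refine (mul_eq_zero_iff_left (hη 0)).mp ?_
    linear_combination x (Il 0) * hl5 + x (Im 2 5) * hm02 + x (Im 3 5) * hm03 - x (Im 1 5) * hm01
      - x (Im 4 5) * hm04
  have he0 : x (Il 1) * x (Im 0 1) - x (Il 2) * x (Im 0 2) - x (Il 3) * x (Im 0 3)
        - x (Il 4) * x (Im 0 4) - x (Il 5) * x (Im 0 5) = 0 := by
    refine (mul_eq_zero_iff_left (hη 0)).mp ?_
    linear_combination x (Ie 1) * he1 + x (Il 1) * hl1 + x (Im 0 2) * hm02 + x (Im 0 3) * hm03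
      + x (Im 0 4) * hm04 + x (Im 0 5) * hm05 - x (Il 0) * hl0 - x (Im 1 2) * hm12
      - x (Im 1 3) * hm13 - x (Im 1 4) * hm14 - x (Im 1 5) * hm15
  rintro (i | ⟨⟨i, j⟩, hij⟩ | i)
  · change eval x (pderiv (Ie i) (Fcubic K)) = 0
    rw [eval_pderiv_Ie_Fcubic]
    fin_cases i <;> assumption
  · change eval x (pderiv (Im i j hij) (Fcubic K)) = 0
    rw [eval_pderiv_Im_Fcubic]
    fin_cases i <;> fin_cases j <;> first | exact absurd hij (by decide) | assumption
  · change eval x (pderiv (Il i) (Fcubic K)) = 0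
    rw [eval_pderiv_Il_Fcubic]
    fin_cases i <;> assumption
end

section
/- The projection K^27 → K^17 onto the 17 coordinates (η'_1, η'_2, …, η'_6, μ'_{2,3}, μ'_{2,4}, …, μ'_{5,6}, λ'_1) (where μ'_{j,k} ranges over the ten pairs 2 ≤ j < k ≤ 6) restricts to a bijection from the set {x ∈ H_6 : η'_1 ≠ 0, …, η'_6 ≠ 0} onto the set of tuples in K^17 whose six coordinates η'_1, …, η'_6 are all nonzero, the remaining eleven coordinates μ'_{j,k} (2 ≤ j < k ≤ 6) and λ'_1 being arbitrary. -/
open MvPolynomial Matrix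

variable (K : Type) [Field K]

/-- Index pairs `(j,k)` with `2 ≤ j < k ≤ 6` (0-based: `0 < j < k`),
for the coordinates `μ'_{j,k}` kept by the projection. -/
abbrev Q6 := {p : Fin 6 × Fin 6 // (0 : Fin 6) < p.1 ∧ p.1 < p.2}

/-- The projection of `K^27` onto the 17 coordinates
`(η'_1,…,η'_6, μ'_{j,k} (2 ≤ j < k ≤ 6), λ'_1)`. -/
def proj17 (x : I27 → K) : (Fin 6 → K) × (Q6 → K) × K :=
  (fun i => x (Ie i), fun q => x (Sum.inr (Sum.inl ⟨q.1, q.2.2⟩)), x (Il 0))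

/-- Each partial derivative of `F`, through those of the entries of `M₁`, `M₂`, `M₃`. -/
theorem eval_pderiv_Fcubic (x : I27 → K) (v : I27) :
    eval x (pderiv v (Fcubic K)) =
      (((M1 K).adjugate - M2 K * M3 K).map (eval x) *
          (M1 K).map (fun p => eval x (pderiv v p))).trace +
        (((M2 K).adjugate - M3 K * M1 K).map (eval x) *
          (M2 K).map (fun p => eval x (pderiv v p))).trace +
        (((M3 K).adjugate - M1 K * M2 K).map (eval x) *
          (M3 K).map (fun p => eval x (pderiv v p))).trace := by
  simp only [Fcubic]
  generalize M1 K = A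
  generalize M2 K = B
  generalize M3 K = C
  simp only [det_fin_three, adjugate_fin_three, trace_fin_three, mul_apply, map_apply,
    Matrix.sub_apply,
    Fin.sum_univ_three, map_add, map_sub, map_neg, map_mul, Derivation.leibniz, smul_eq_mul,
    of_apply, cons_val', cons_val_zero, cons_val_one, cons_val, cons_val_fin_one]
  ring

theorem H6mem_of_adjugate_eq {x : I27 → K}
    (hA : ((M1 K).adjugate - M2 K * M3 K).map (eval x) = 0)
    (hB : ((M2 K).adjugate - M3 K * M1 K).map (eval x) = 0)
    (hC : ((M3 K).adjugate - M1 K * M2 K).map (eval x) = 0) : H6mem K x := by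
  intro v
  rw [eval_pderiv_Fcubic, hA, hB, hC]
  simp

/-- The rational section of `proj17` over the locus where the coordinate `Ie 0` is nonzero. -/
def lift17 (w : (Fin 6 → K) × (Q6 → K) × K) : I27 → K :=
  let e := w.1
  let m (i j : Fin 6) (h : 0 < i ∧ i < j := by decide) : K := w.2.1 ⟨(i, j), h⟩
  let l := w.2.2
  Sum.elim e (Sum.elim
    (fun p => if h : 0 < p.1.1 then m p.1.1 p.1.2 ⟨h, p.2⟩ else
      ![0,
        (m 1 2 * e 2 + (e 3 * m 1 3 + e 4 * m 1 4 + e 5 * m 1 5)) / e 0,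
        (m 1 2 * e 1 - (e 3 * m 2 3 + e 4 * m 2 4 + e 5 * m 2 5)) / e 0,
        (e 4 * m 3 4 - e 5 * m 3 5 - m 1 3 * e 1 - m 2 3 * e 2) / e 0,
        (e 5 * m 4 5 - e 3 * m 3 4 - m 1 4 * e 1 - m 2 4 * e 2) / e 0,
        (e 3 * m 3 5 - e 4 * m 4 5 - m 1 5 * e 1 - m 2 5 * e 2) / e 0] p.1.2)
    ![l,
      (l * e 1 + (m 4 5 * m 2 3 + m 3 5 * m 2 4 + m 3 4 * m 2 5)) / e 0,
      (l * e 2 - (m 4 5 * m 1 3 + m 3 5 * m 1 4 + m 3 4 * m 1 5)) / e 0,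
      (m 1 4 * m 2 5 - m 2 4 * m 1 5 - l * e 3 - m 1 2 * m 4 5) / e 0,
      (m 2 3 * m 1 5 - m 1 3 * m 2 5 - l * e 4 - m 1 2 * m 3 5) / e 0,
      (m 1 3 * m 2 4 - m 2 3 * m 1 4 - l * e 5 - m 1 2 * m 3 4) / e 0])

theorem proj17_lift17 (w : (Fin 6 → K) × (Q6 → K) × K) : proj17 K (lift17 K w) = w := by
  refine Prod.ext rfl (Prod.ext ?_ rfl)
  funext q
  simp [proj17, lift17, q.2.1]

set_option maxHeartbeats 1000000 in
theorem H6mem_lift17 {w : (Fin 6 → K) × (Q6 → K) × K} (hw : w.1 0 ≠ 0) :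
    H6mem K (lift17 K w) := by
  apply H6mem_of_adjugate_eq <;>
  · ext i j
    fin_cases i <;> fin_cases j <;>
    · simp [M1, M2, M3, adjugate_fin_three, lift17, Ie, Im, Il]
      field_simp
      ring

set_option maxHeartbeats 1000000 in
theorem lift17_proj17 {x : I27 → K} (hx : H6mem K x) (h0 : x (Ie 0) ≠ 0) :
    lift17 K (proj17 K x) = x := by
  have key (v : I27) := (eval_pderiv_Fcubic K x v).symm.trans (hx v)
  simp only [M1, M2, M3, adjugate_fin_three, trace_fin_three, mul_apply, Fin.sum_univ_three,
    map_apply, Matrix.sub_apply, of_apply, cons_val', cons_val_zero, cons_val_one, cons_val,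
    cons_val_fin_one, pderiv_X, eval_X, map_add, map_sub, map_neg, map_mul] at key
  have hm1 := key (Il 1)
  have hm2 := key (Il 2)
  have hm3 := key (Il 3)
  have hm4 := key (Il 4)
  have hm5 := key (Il 5)
  have hl1 := key (Im 0 1)
  have hl2 := key (Im 0 2)
  have hl3 := key (Im 0 3)
  have hl4 := key (Im 0 4)
  have hl5 := key (Im 0 5)
  clear key
  simp [Ie, Im, Il] at hm1 hm2 hm3 hm4 hm5 hl1 hl2 hl3 hl4 hl5
  simp only [Ie] at h0
  funext v
  rcases v with i | ⟨⟨i, j⟩, hij⟩ | i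
  · rfl
  · by_cases hi : 0 < i
    · simp [lift17, proj17, hi]
    · obtain rfl : i = 0 := by omega
      fin_cases j
      · exact absurd hij (lt_irrefl _)
      all_goals simp [lift17, proj17, Ie, Il]; rw [div_eq_iff h0]
      · linear_combination -hm1
      · linear_combination hm2
      · linear_combination hm3
      · linear_combination hm4
      · linear_combination hm5
  · fin_cases i
    · rfl
    all_goals simp [lift17, proj17, Ie, Il]; rw [div_eq_iff h0]
    · linear_combination -hl1
    · linear_combination hl2
    · linear_combination hl3
    · linear_combination hl4
    · linear_combination hl5

theorem statement3 [IsAlgClosed K] [CharZero K] :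
    Set.BijOn (proj17 K)
      {x : I27 → K | H6mem K x ∧ ∀ i : Fin 6, x (Ie i) ≠ 0}
      {w : (Fin 6 → K) × (Q6 → K) × K | ∀ i : Fin 6, w.1 i ≠ 0} :=
  Set.InvOn.bijOn
      ⟨fun _ hx => lift17_proj17 K hx.1 (hx.2 0), fun w _ => proj17_lift17 K w⟩
      (fun _ hx => hx.2) fun _ hw => ⟨H6mem_lift17 K (hw 0), hw⟩
end

section
/- Set η'_1 = ⋯ = η'_7 = 1 (that is, x^{i8} = 1 for i = 1, …, 7), and fix arbitrary values μ'_{j,k} ∈ K for 2 ≤ j < k ≤ 7 and ν'_{1,l} ∈ K for l = 2, …, 7. Then there exists a unique choice of the remaining 28 coordinates μ'_{1,i} (i = 2,…,7), ν'_{j,k} (2 ≤ j < k ≤ 7), and λ'_l (l = 1,…,7) such that the resulting point of K^56 lies on H_7, i.e., satisfies all equations u^{ijkl} = 0, v^i_j = 0 (i ≠ j), and v^i_i = 0. -/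
/-- Index pairs `(i,j)` with `i < j` in `{1,…,8}` (0-based `Fin 8`). -/
abbrev P8 := {p : Fin 8 × Fin 8 // p.1 < p.2}

/-- The 56 coordinates: `x^{ij}` (left) and `y_{ij}` (right) for `i < j`. -/
abbrev I56 := P8 ⊕ P8

variable {K : Type} [Field K]

/-- The antisymmetric extension `x^{ij}` (with `x^{ji} = −x^{ij}`, `x^{ii} = 0`). -/
def xc (z : I56 → K) (i j : Fin 8) : K :=
  if h : i < j then z (Sum.inl ⟨(i, j), h⟩)
  else if h : j < i then -z (Sum.inl ⟨(j, i), h⟩) else 0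

/-- The antisymmetric extension `y_{ij}` (with `y_{ji} = −y_{ij}`, `y_{ii} = 0`). -/
def yc (z : I56 → K) (i j : Fin 8) : K :=
  if h : i < j then z (Sum.inr ⟨(i, j), h⟩)
  else if h : j < i then -z (Sum.inr ⟨(j, i), h⟩) else 0

/-- The quadric `u^{ijkl}` for `i<j<k<l` with sorted complement `a<b<c<d`; the sign
`σ` of the shuffle permutation `(i,j,k,l,a,b,c,d)` equals `(−1)^{i+j+k+l}` (0-based). -/
def uEq (z : I56 → K) (i j k l a b c d : Fin 8) : K :=
  xc z i j * xc z k l - xc z i k * xc z j l + xc z i l * xc z j k +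
    (-1 : K) ^ ((i : ℕ) + (j : ℕ) + (k : ℕ) + (l : ℕ)) *
      (yc z a b * yc z c d - yc z a c * yc z b d + yc z a d * yc z b c)

/-- The quadric `v^i_j = Σ_{k ∉ {i,j}} x^{ik} y_{kj}` for `i ≠ j`. -/
def vEq (z : I56 → K) (i j : Fin 8) : K :=
  ∑ k ∈ Finset.univ \ {i, j}, xc z i k * yc z k j

/-- The quadric `v^i_i = −(3/4) Σ_{j≠i} x^{ij}y_{ij} + (1/4) Σ_{j<k, j,k≠i} x^{jk}y_{jk}`. -/
def vDiag (z : I56 → K) (i : Fin 8) : K :=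
  -((3 / 4 : K) * (∑ j ∈ Finset.univ \ {i}, xc z i j * yc z i j))
    + (1 / 4 : K) * (∑ p ∈ Finset.univ.filter
        (fun p : Fin 8 × Fin 8 => p.1 < p.2 ∧ p.1 ≠ i ∧ p.2 ≠ i),
        xc z p.1 p.2 * yc z p.1 p.2)

/-- Membership in the affine cone `H₇` over `G₇/P₇`: all equations
`u^{ijkl} = 0`, `v^i_j = 0` (`i ≠ j`) and `v^i_i = 0` hold. -/
def H7mem (z : I56 → K) : Prop :=
  (∀ i j k l a b c d : Fin 8, i < j → j < k → k < l → a < b → b < c → c < d →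
      ({i, j, k, l, a, b, c, d} : Finset (Fin 8)) = Finset.univ →
      uEq z i j k l a b c d = 0) ∧
  (∀ i j : Fin 8, i ≠ j → vEq z i j = 0) ∧
  (∀ i : Fin 8, vDiag z i = 0)

theorem xc_self (z : I56 → K) (i : Fin 8) : xc z i i = 0 := by simp [xc]

theorem yc_self (z : I56 → K) (i : Fin 8) : yc z i i = 0 := by simp [yc]

theorem xc_of_lt (z : I56 → K) {i j : Fin 8} (h : i < j) :
    xc z i j = z (Sum.inl ⟨(i, j), h⟩) := dif_pos h

theorem yc_of_lt (z : I56 → K) {i j : Fin 8} (h : i < j) :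
    yc z i j = z (Sum.inr ⟨(i, j), h⟩) := dif_pos h

theorem xc_swap (z : I56 → K) {i j : Fin 8} (h : j < i) : xc z i j = -xc z j i := by
  simp [xc, h, h.not_gt]

theorem yc_swap (z : I56 → K) {i j : Fin 8} (h : j < i) : yc z i j = -yc z j i := by
  simp [yc, h, h.not_gt]

theorem yc_antisymm (z : I56 → K) (i j : Fin 8) : yc z i j = -yc z j i := by
  obtain h | rfl | h := lt_trichotomy i j
  · rw [yc_swap z h, neg_neg]
  · simp [yc_self]
  · exact yc_swap z h

/-- The Pfaffian of the `4 × 4` minor of `A` with (ordered) indices `i, j, k, l`. -/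
def pfaffian (A : Fin 8 → Fin 8 → K) (i j k l : Fin 8) : K :=
  A i j * A k l - A i k * A j l + A i l * A j k

theorem pfaffian_congr {A B : Fin 8 → Fin 8 → K} {s : Finset (Fin 8)}
    (h : ∀ i j, i ∈ s → j ∈ s → A i j = B i j) {i j k l : Fin 8} (hi : i ∈ s) (hj : j ∈ s)
    (hk : k ∈ s) (hl : l ∈ s) : pfaffian A i j k l = pfaffian B i j k l := by
  simp only [pfaffian, h _ _ hi hj, h _ _ hk hl, h _ _ hi hk, h _ _ hj hl, h _ _ hi hl,
    h _ _ hj hk]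

/-- For `i < j < k < l`, the increasing enumeration, over `t = 0, 1, 2, 3`, of the indices
different from `i`, `j`, `k` and `l`. -/
def complement (i j k l t : Fin 8) : Fin 8 :=
  if t < i then t else if t + 1 < j then t + 1 else if t + 2 < k then t + 2
  else if t + 3 < l then t + 3 else t + 4

/-- The quadric `u^{ijkl}`, with the complementary indices computed. -/
def quadric (z : I56 → K) (i j k l : Fin 8) : K :=
  pfaffian (xc z) i j k l + (-1) ^ ((i : ℕ) + j + k + l) *
    pfaffian (yc z) (complement i j k l 0) (complement i j k l 1) (complement i j k l 2)
      (complement i j k l 3)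

theorem complement_spec : ∀ i j : Fin 8, i < j → ∀ k, j < k → ∀ l, k < l →
    complement i j k l 0 < complement i j k l 1 ∧ complement i j k l 1 < complement i j k l 2 ∧
    complement i j k l 2 < complement i j k l 3 ∧
    ({i, j, k, l, complement i j k l 0, complement i j k l 1, complement i j k l 2,
      complement i j k l 3} : Finset (Fin 8)) = Finset.univ := by
  decide +kernel

theorem complement_mem_Ioo : ∀ j k : Fin 8, 0 < j → j < k → k < 7 → ∀ t < 4,
    complement 0 j k 7 t ∈ Finset.Ioo 0 7 := by
  decide +kernel

set_option synthInstance.maxSize 1000 in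
set_option synthInstance.maxHeartbeats 400000 in
theorem eq_complement_of_notMem : ∀ i j : Fin 8, i < j → ∀ k, j < k → ∀ l, k < l →
    ∀ a, a ∉ [i, j, k, l] → ∀ b, a < b → b ∉ [i, j, k, l] → ∀ c, b < c → c ∉ [i, j, k, l] →
    ∀ d, c < d → d ∉ [i, j, k, l] →
    a = complement i j k l 0 ∧ b = complement i j k l 1 ∧ c = complement i j k l 2 ∧
      d = complement i j k l 3 := by
  decide +kernel

theorem injective_of_insert_eq_univ {i j k l a b c d : Fin 8}
    (h : ({i, j, k, l, a, b, c, d} : Finset (Fin 8)) = Finset.univ) :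
    Function.Injective ![i, j, k, l, a, b, c, d] := by
  refine Finite.injective_iff_surjective.2 fun m => ?_
  have hm : m ∈ ({i, j, k, l, a, b, c, d} : Finset (Fin 8)) := h ▸ Finset.mem_univ m
  simpa [Fin.exists_fin_succ, eq_comm] using hm

theorem forall_uEq_iff (z : I56 → K) :
    (∀ i j k l a b c d : Fin 8, i < j → j < k → k < l → a < b → b < c → c < d →
      ({i, j, k, l, a, b, c, d} : Finset (Fin 8)) = Finset.univ →
      uEq z i j k l a b c d = 0) ↔
    ∀ i j k l : Fin 8, i < j → j < k → k < l → quadric z i j k l = 0 := by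
  refine ⟨fun h i j k l hij hjk hkl => ?_, fun h i j k l a b c d hij hjk hkl hab hbc hcd hu => ?_⟩
  · obtain ⟨h₁, h₂, h₃, hu⟩ := complement_spec i j hij k hjk l hkl
    exact h i j k l _ _ _ _ hij hjk hkl h₁ h₂ h₃ hu
  · have hne {s t : Fin 8} (hst : s ≠ t) := (injective_of_insert_eq_univ hu).ne hst
    have hmem (t : Fin 8) (ht : 3 < t) : ![i, j, k, l, a, b, c, d] t ∉ [i, j, k, l] := by
      simpa using ⟨hne (s := t) (t := 0) (by lia), hne (s := t) (t := 1) (by lia),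
        hne (s := t) (t := 2) (by lia), hne (s := t) (t := 3) (by lia)⟩
    obtain ⟨rfl, rfl, rfl, rfl⟩ := eq_complement_of_notMem i j hij k hjk l hkl
      a (hmem 4 (by decide)) b hab (hmem 5 (by decide)) c hbc (hmem 6 (by decide))
      d hcd (hmem 7 (by decide))
    exact h i j k l hij hjk hkl

/-- The defining equations of the big cell `x^{i7} = 1`, solved for the dependent coordinates. -/
structure Solved (z : I56 → K) : Prop where
  x_inner : ∀ j k : Fin 8, 0 < j → j < k → k < 7 → xc z j k = xc z 0 k - xc z 0 j +
    (-1) ^ ((j : ℕ) + (k : ℕ)) *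
      pfaffian (yc z) (complement 0 j k 7 0) (complement 0 j k 7 1) (complement 0 j k 7 2)
        (complement 0 j k 7 3)
  y_first : ∀ i : Fin 8, 0 < i → i < 7 → yc z 0 i = ∑ k ∈ Finset.Ioo 0 7, yc z i k
  y_last : ∀ i : Fin 8, 0 < i → i < 7 → yc z i 7 = ∑ k ∈ Finset.Ioo 0 7, xc z 0 k * yc z k i
  y_corner : yc z 0 7 = ∑ k ∈ Finset.Ioo 1 7, xc z 1 k * yc z k 0

theorem sum_Ioo_zero_seven (f : Fin 8 → K) :
    ∑ k ∈ Finset.Ioo 0 7, f k = f 1 + f 2 + f 3 + f 4 + f 5 + f 6 := by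
  rw [show Finset.Ioo (0 : Fin 8) 7 = {1, 2, 3, 4, 5, 6} by decide]
  simp [Finset.sum_insert, add_assoc]

theorem sum_Ioo_one_seven (f : Fin 8 → K) :
    ∑ k ∈ Finset.Ioo 1 7, f k = f 2 + f 3 + f 4 + f 5 + f 6 := by
  rw [show Finset.Ioo (1 : Fin 8) 7 = {2, 3, 4, 5, 6} by decide]
  simp [Finset.sum_insert, add_assoc]

theorem vEq_eq_sum (z : I56 → K) (i j : Fin 8) : vEq z i j = ∑ k, xc z i k * yc z k j := by
  refine Finset.sum_subset (Finset.subset_univ _) fun k _ hk => ?_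
  obtain rfl | rfl : k = i ∨ k = j := by simpa [or_iff_not_imp_left] using hk
  · simp [xc_self]
  · simp [yc_self]

theorem vDiag_eq [CharZero K] (z : I56 → K) (i : Fin 8) :
    vDiag z i = 1 / 4 * (∑ p : Fin 8 × Fin 8 with p.1 < p.2, xc z p.1 p.2 * yc z p.1 p.2)
      + ∑ k, xc z i k * yc z k i := by
  have hs : ∑ j ∈ Finset.univ \ {i}, xc z i j * yc z i j = ∑ j, xc z i j * yc z i j :=
    Finset.sum_subset (Finset.subset_univ _) fun j _ hj => by
      obtain rfl : j = i := by simpa using hj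
      simp [xc_self]
  rw [vDiag, hs]
  fin_cases i <;>
    simp +decide only [Finset.sum_filter, Fintype.sum_prod_type, Fin.sum_univ_eight,
      xc_self, yc_self, xc_swap, yc_swap, if_true, if_false,
      Fin.reduceFinMk, Fin.zero_eta, Fin.mk_one, Fin.isValue] <;>
    ring

theorem sum_product_diag (z : I56 → K) : ∑ i, ∑ k, xc z i k * yc z k i =
    -2 * ∑ p : Fin 8 × Fin 8 with p.1 < p.2, xc z p.1 p.2 * yc z p.1 p.2 := by
  simp +decide only [Finset.sum_filter, Fintype.sum_prod_type, Fin.sum_univ_eight,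
    xc_self, yc_self, xc_swap, yc_swap, if_true, if_false]
  ring

theorem vDiag_eq_zero [CharZero K] {z : I56 → K} {c : K}
    (h : ∀ i, ∑ k, xc z i k * yc z k i = c) (i : Fin 8) : vDiag z i = 0 := by
  have hs := sum_product_diag z
  simp only [h, Finset.sum_const, Finset.card_univ, Fintype.card_fin, nsmul_eq_mul] at hs
  rw [vDiag_eq, h]
  push_cast at hs
  linear_combination (1 / 8) * hs

set_option maxHeartbeats 40000000 in
-- Each of the 64 entries is a polynomial identity in the 21 free coordinates.
theorem Solved.product {z : I56 → K} (h : Solved z) (hη : ∀ i : Fin 8, i < 7 → xc z i 7 = 1)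
    (i j : Fin 8) :
    ∑ k, xc z i k * yc z k j = if i = j then ∑ k, xc z 0 k * yc z k 0 else 0 := by
  fin_cases i <;> fin_cases j <;>
    simp +decide only [Fin.sum_univ_eight, h.x_inner, h.y_corner, h.y_first, h.y_last, hη, xc_self,
      yc_self, xc_swap, yc_swap, sum_Ioo_zero_seven, sum_Ioo_one_seven, complement, pfaffian,
      if_true, if_false, Fin.reduceFinMk, Fin.reduceAdd, Fin.coe_ofNat_eq_mod, Nat.reduceMod,
      Nat.reduceAdd, Fin.zero_eta, Fin.mk_one, Fin.isValue]
  all_goals ring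

set_option maxHeartbeats 40000000 in
-- Each of the 70 quadrics gives a polynomial identity in the 21 free coordinates.
theorem Solved.quadric_eq_zero {z : I56 → K} (h : Solved z)
    (hη : ∀ i : Fin 8, i < 7 → xc z i 7 = 1) (i j k l : Fin 8) (hij : i < j) (hjk : j < k)
    (hkl : k < l) : quadric z i j k l = 0 := by
  fin_cases i <;> fin_cases j <;> first | exact absurd hij (by decide) | skip
  all_goals fin_cases k <;> first | exact absurd hjk (by decide) | skip
  all_goals fin_cases l <;> first | exact absurd hkl (by decide) | skip
  all_goals
    simp +decide only [quadric, h.x_inner, h.y_corner, h.y_first, h.y_last, hη,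
      yc_self, yc_swap, sum_Ioo_zero_seven, sum_Ioo_one_seven, complement, pfaffian,
      if_true, if_false, Fin.reduceFinMk, Fin.reduceAdd, Fin.coe_ofNat_eq_mod, Nat.reduceMod,
      Nat.reduceAdd, Fin.zero_eta, Fin.mk_one, Fin.isValue]
  all_goals ring

theorem Solved.mem [CharZero K] {z : I56 → K} (h : Solved z)
    (hη : ∀ i : Fin 8, i < 7 → xc z i 7 = 1) : H7mem z := by
  refine ⟨(forall_uEq_iff z).2 (h.quadric_eq_zero hη), fun i j hij => ?_,
    vDiag_eq_zero fun i => (h.product hη i i).trans (if_pos rfl)⟩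
  rw [vEq_eq_sum, h.product hη, if_neg hij]

theorem H7mem.solved {z : I56 → K} (h : H7mem z) (hη : ∀ i : Fin 8, i < 7 → xc z i 7 = 1) :
    Solved z := by
  obtain ⟨hu, hv, -⟩ := h
  rw [forall_uEq_iff] at hu
  refine ⟨fun j k hj hjk hk => ?_, fun i hi hi' => ?_, fun i hi hi' => ?_, ?_⟩
  · have := hu 0 j k 7 hj hjk hk
    have hsign : (-1 : K) ^ ((0 : ℕ) + j + k + 7) = -(-1) ^ ((j : ℕ) + k) := by
      rw [pow_add, zero_add]; norm_num
    simp only [quadric, Fin.isValue, Fin.coe_ofNat_eq_mod, Nat.zero_mod, Nat.reduceMod,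
      hsign] at this
    rw [pfaffian, hη 0 (by decide), hη j (hjk.trans hk), hη k hk] at this
    linear_combination this
  · have := hv 7 i hi'.ne'
    rw [vEq_eq_sum, Fin.sum_univ_eight, xc_self, xc_swap z (show (0 : Fin 8) < 7 by decide),
      xc_swap z (show (1 : Fin 8) < 7 by decide), xc_swap z (show (2 : Fin 8) < 7 by decide),
      xc_swap z (show (3 : Fin 8) < 7 by decide), xc_swap z (show (4 : Fin 8) < 7 by decide),
      xc_swap z (show (5 : Fin 8) < 7 by decide), xc_swap z (show (6 : Fin 8) < 7 by decide)] at this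
    simp +decide only [hη] at this
    simp only [sum_Ioo_zero_seven, yc_antisymm z i]
    linear_combination -this
  · have := hv 0 i hi.ne
    rw [vEq_eq_sum, Fin.sum_univ_eight, xc_self, hη 0 (by decide), yc_swap z hi'] at this
    rw [sum_Ioo_zero_seven]
    linear_combination -this
  · have := hv 1 0 (by decide)
    rw [vEq_eq_sum, Fin.sum_univ_eight, xc_self, yc_self, hη 1 (by decide),
      yc_swap z (show (0 : Fin 8) < 7 by decide)] at this
    rw [sum_Ioo_one_seven]
    linear_combination -this

theorem Solved.ext {z w : I56 → K} (hz : Solved z) (hw : Solved w)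
    (hη : ∀ i : Fin 8, i < 7 → xc z i 7 = xc w i 7)
    (hμ : ∀ j k : Fin 8, 0 < j → j < k → k < 7 → yc z j k = yc w j k)
    (hν : ∀ l : Fin 8, 0 < l → l < 7 → xc z 0 l = xc w 0 l) : z = w := by
  have hy (j k : Fin 8) (hj : j ∈ Finset.Ioo 0 7) (hk : k ∈ Finset.Ioo 0 7) :
      yc z j k = yc w j k := by
    rw [Finset.mem_Ioo] at hj hk
    obtain h | rfl | h := lt_trichotomy j k
    · exact hμ j k hj.1 h hk.2
    · simp only [yc_self]
    · rw [yc_swap z h, yc_swap w h, hμ k j hk.1 h hj.2]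
  have hx (j k : Fin 8) (hj : 0 < j) (hjk : j < k) (hk : k < 7) : xc z j k = xc w j k := by
    have hc := complement_mem_Ioo j k hj hjk hk
    rw [hz.x_inner j k hj hjk hk, hw.x_inner j k hj hjk hk, hν k (hj.trans hjk) hk,
      hν j hj (hjk.trans hk), pfaffian_congr hy (hc 0 (by decide)) (hc 1 (by decide))
        (hc 2 (by decide)) (hc 3 (by decide))]
  have hy₀ (k : Fin 8) (hk : 0 < k) (hk' : k < 7) : yc z 0 k = yc w 0 k := by
    rw [hz.y_first k hk hk', hw.y_first k hk hk']
    exact Finset.sum_congr rfl fun i hi => hy k i (Finset.mem_Ioo.2 ⟨hk, hk'⟩) hi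
  ext (⟨⟨j, k⟩, hjk⟩ | ⟨⟨j, k⟩, hjk⟩)
  · rw [← xc_of_lt z hjk, ← xc_of_lt w hjk]
    dsimp only at hjk
    obtain rfl | hk := (show k ≤ 7 by lia).eq_or_lt
    · exact hη j hjk
    obtain rfl | hj := (Fin.zero_le j).eq_or_lt
    · exact hν k hjk hk
    · exact hx j k hj hjk hk
  · rw [← yc_of_lt z hjk, ← yc_of_lt w hjk]
    dsimp only at hjk
    obtain rfl | hk := (show k ≤ 7 by lia).eq_or_lt <;> obtain rfl | hj := (Fin.zero_le j).eq_or_lt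
    · rw [hz.y_corner, hw.y_corner]
      refine Finset.sum_congr rfl fun k hk => ?_
      rw [Finset.mem_Ioo] at hk
      have hk₀ : 0 < k := by lia
      rw [hx 1 k (by decide) hk.1 hk.2, yc_swap z hk₀, yc_swap w hk₀, hy₀ k hk₀ hk.2]
    · rw [hz.y_last j hj hjk, hw.y_last j hj hjk]
      refine Finset.sum_congr rfl fun k hk => ?_
      rw [hy k j hk (Finset.mem_Ioo.2 ⟨hj, hjk⟩),
        hν k (Finset.mem_Ioo.1 hk).1 (Finset.mem_Ioo.1 hk).2]
    · exact hy₀ k hjk hk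
    · exact hμ j k hj hjk hk

/-- The coordinates `x^{jk}`, `j < k`, of the point of the big cell with `x^{0l} = a l` and
inner coordinates `y_{jk} = m j k`. -/
def bigCellX (a : Fin 8 → K) (m : Fin 8 → Fin 8 → K) (j k : Fin 8) : K :=
  if k = 7 then 1 else if j = 0 then a k else a k - a j + (-1) ^ ((j : ℕ) + (k : ℕ)) *
    pfaffian m (complement 0 j k 7 0) (complement 0 j k 7 1) (complement 0 j k 7 2)
      (complement 0 j k 7 3)

/-- The coordinates `y_{jk}`, `j < k`, of the point of the big cell with `x^{0l} = a l` and
inner coordinates `y_{jk} = m j k`. -/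
def bigCellY (a : Fin 8 → K) (m : Fin 8 → Fin 8 → K) (j k : Fin 8) : K :=
  if k = 7 then
    if j = 0 then ∑ k ∈ Finset.Ioo 1 7, bigCellX a m 1 k * -∑ i ∈ Finset.Ioo 0 7, m k i
    else ∑ i ∈ Finset.Ioo 0 7, a i * m i j
  else if j = 0 then ∑ i ∈ Finset.Ioo 0 7, m k i else m j k

theorem exists_solved (μv : Fin 8 → Fin 8 → K) (νv : Fin 8 → K) :
    ∃ z : I56 → K, Solved z ∧ (∀ i : Fin 8, i < 7 → xc z i 7 = 1)
      ∧ (∀ j k : Fin 8, 0 < j → j < k → k < 7 → yc z j k = μv j k)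
      ∧ (∀ l : Fin 8, 0 < l → l < 7 → xc z 0 l = νv l) := by
  let m := yc (Sum.elim 0 fun p => μv p.1.1 p.1.2 : I56 → K)
  let z : I56 → K := Sum.elim (fun p => bigCellX νv m p.1.1 p.1.2)
    (fun p => bigCellY νv m p.1.1 p.1.2)
  have hX {j k : Fin 8} (h : j < k) : xc z j k = bigCellX νv m j k := xc_of_lt z h
  have hY {j k : Fin 8} (h : j < k) : yc z j k = bigCellY νv m j k := yc_of_lt z h
  have hη (i : Fin 8) (h : i < 7) : xc z i 7 = 1 := by simp [hX h, bigCellX]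
  have hν (l : Fin 8) (h : 0 < l) (h' : l < 7) : xc z 0 l = νv l := by
    simp [hX h, bigCellX, h'.ne]
  have hlt {j k : Fin 8} (hj : 0 < j) (h : j < k) (hk : k < 7) : yc z j k = m j k := by
    simp [hY h, bigCellY, hk.ne, hj.ne']
  have hm (j k : Fin 8) (hj : j ∈ Finset.Ioo 0 7) (hk : k ∈ Finset.Ioo 0 7) :
      yc z j k = m j k := by
    rw [Finset.mem_Ioo] at hj hk
    obtain h | rfl | h := lt_trichotomy j k
    · exact hlt hj.1 h hk.2
    · simp only [m, yc_self]
    · rw [yc_swap z h, hlt hk.1 h hj.2]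
      exact (yc_swap _ h).symm
  have hy₀ (k : Fin 8) (hk : 0 < k) (hk' : k < 7) : yc z 0 k = ∑ i ∈ Finset.Ioo 0 7, m k i := by
    simp [hY hk, bigCellY, hk'.ne]
  refine ⟨z, ⟨fun j k hj hjk hk => ?_, fun i hi hi' => ?_, fun i hi hi' => ?_, ?_⟩, hη,
    fun j k hj hjk hk => ?_, hν⟩
  · have hc := complement_mem_Ioo j k hj hjk hk
    rw [hX hjk, bigCellX, if_neg hk.ne, if_neg hj.ne', hν k (hj.trans hjk) hk,
      hν j hj (hjk.trans hk), pfaffian_congr hm (hc 0 (by decide)) (hc 1 (by decide))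
        (hc 2 (by decide)) (hc 3 (by decide))]
  · rw [hy₀ i hi hi']
    exact Finset.sum_congr rfl fun k hk => (hm i k (Finset.mem_Ioo.2 ⟨hi, hi'⟩) hk).symm
  · rw [hY hi', bigCellY, if_pos rfl, if_neg hi.ne']
    refine Finset.sum_congr rfl fun k hk => ?_
    rw [hm k i hk (Finset.mem_Ioo.2 ⟨hi, hi'⟩),
      hν k (Finset.mem_Ioo.1 hk).1 (Finset.mem_Ioo.1 hk).2]
  · rw [hY (by decide), bigCellY, if_pos rfl, if_pos rfl]
    refine Finset.sum_congr rfl fun k hk => ?_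
    rw [Finset.mem_Ioo] at hk
    have hk₀ : 0 < k := by lia
    rw [hX hk.1, yc_swap z hk₀, hy₀ k hk₀ hk.2]
  · rw [hlt hj hjk hk]
    exact yc_of_lt _ hjk

theorem statement4 [IsAlgClosed K] [CharZero K]
    (μv : Fin 8 → Fin 8 → K) (νv : Fin 8 → K) :
    ∃! z : I56 → K, H7mem z
      ∧ (∀ i : Fin 8, i < 7 → xc z i 7 = 1)
      ∧ (∀ j k : Fin 8, 0 < j → j < k → k < 7 → yc z j k = μv j k)
      ∧ (∀ l : Fin 8, 0 < l → l < 7 → xc z 0 l = νv l) := by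
  obtain ⟨z, hz, hη, hμ, hν⟩ := exists_solved μv νv
  refine ⟨z, ⟨hz.mem hη, hη, hμ, hν⟩, fun w ⟨hw, hwη, hwμ, hwν⟩ => ?_⟩
  refine (hw.solved hwη).ext hz (fun i hi => ?_) (fun j k hj hjk hk => ?_) fun l hl hl' => ?_
  · rw [hwη i hi, hη i hi]
  · rw [hwμ j k hj hjk hk, hμ j k hj hjk hk]
  · rw [hwν l hl hl', hν l hl hl']
end

section
/- Assume K is infinite (for instance algebraically closed of characteristic 0) and that a, b, c, d ∉ {0, 1}, a ≠ b, a ≠ c, b ≠ d, c ≠ d, γ_1 ≠ 0, γ_2 ≠ 0, γ_3 ≠ 0. Then there exist values η''_1, …, η''_6, μ''_{i,j} (1 ≤ i < j ≤ 6), λ''_1, …, λ''_6 in K, all nonzero, at which all twenty rescaling conditions g_{D,i} vanish. -/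
open MvPolynomial in
/-- Over an infinite field, finitely many polynomials, none of which vanishes identically, have a
common point of non-vanishing. -/
theorem exists_forall_mem_eval_ne_zero {K σ : Type*} [Field K] [Infinite K]
    (l : List (MvPolynomial σ K)) (h : ∀ p ∈ l, ∃ x, eval x p ≠ 0) :
    ∃ x, ∀ p ∈ l, eval x p ≠ 0 := by
  have hl : l.prod ≠ 0 := by
    refine List.prod_ne_zero fun h0 => ?_
    obtain ⟨x, hx⟩ := h 0 h0
    exact hx (map_zero _)
  by_contra! hcon
  refine hl (MvPolynomial.funext fun x => ?_)
  obtain ⟨p, hp, hpx⟩ := hcon x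
  obtain ⟨q, hq⟩ := List.dvd_prod hp
  rw [hq, map_mul, hpx, zero_mul, map_zero]

open MvPolynomial in
theorem statement11 {K : Type} [Field K] [CharZero K]
    (a b c d : K)
    (ha0 : a ≠ 0) (ha1 : a ≠ 1) (hb0 : b ≠ 0) (hb1 : b ≠ 1)
    (hc0 : c ≠ 0) (hc1 : c ≠ 1) (hd0 : d ≠ 0) (hd1 : d ≠ 1)
    (hab : a ≠ b) (hac : a ≠ c) (hbd : b ≠ d) (hcd : c ≠ d)
    (γ1 γ2 γ3 : K)
    (hγ1 : γ1 = a * d - b * c)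
    (hγ2 : γ2 = (a - 1) * (d - 1) - (b - 1) * (c - 1))
    (hγ3 : γ3 = d * (a - c) * (1 - b) - c * (b - d) * (1 - a))
    (hγ1ne : γ1 ≠ 0) (hγ2ne : γ2 ≠ 0) (hγ3ne : γ3 ≠ 0) :
    ∃ η1 η2 η3 η4 η5 η6 μ12 μ13 μ14 μ15 μ16 μ23 μ24 μ25 μ26 μ34 μ35 μ36 μ45 μ46 μ56
      lam1 lam2 lam3 lam4 lam5 lam6 : K,
      η1 ≠ 0 ∧ η2 ≠ 0 ∧ η3 ≠ 0 ∧ η4 ≠ 0 ∧ η5 ≠ 0 ∧ η6 ≠ 0 ∧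
      μ12 ≠ 0 ∧ μ13 ≠ 0 ∧ μ14 ≠ 0 ∧ μ15 ≠ 0 ∧ μ16 ≠ 0 ∧
      μ23 ≠ 0 ∧ μ24 ≠ 0 ∧ μ25 ≠ 0 ∧ μ26 ≠ 0 ∧
      μ34 ≠ 0 ∧ μ35 ≠ 0 ∧ μ36 ≠ 0 ∧ μ45 ≠ 0 ∧ μ46 ≠ 0 ∧ μ56 ≠ 0 ∧
      lam1 ≠ 0 ∧ lam2 ≠ 0 ∧ lam3 ≠ 0 ∧ lam4 ≠ 0 ∧ lam5 ≠ 0 ∧ lam6 ≠ 0 ∧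
      (-(η3 * μ23) - η4 * μ24 - b * η5 * μ25 - d * η6 * μ26 = 0) ∧
      (η1 * μ12 + η4 * μ24 + η5 * μ25 + η6 * μ26 = 0) ∧
      (-(η1 * μ13) + η4 * μ34 + η5 * μ35 + η6 * μ36 = 0) ∧
      (η2 * μ23 + η4 * μ34 + a * η5 * μ35 + c * η6 * μ36 = 0) ∧
      (-(η1 * μ14) + η3 * μ34 + (b - 1) * η5 * μ45 + (1 - d) * η6 * μ46 = 0) ∧
      (-(η2 * μ24) + η3 * μ34 + (b - a) * η5 * μ45 + (c - d) * η6 * μ46 = 0) ∧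
      (-(η2 * μ25) + a / b * η3 * μ35 + (a - b) / b * η4 * μ45 + γ1 / b * η6 * μ56 = 0) ∧
      (-(η1 * μ15) + 1 / b * η3 * μ35 + (1 - b) / b * η4 * μ45 + (d - b) / b * η6 * μ56 = 0) ∧
      (-(η1 * μ16) + 1 / d * η3 * μ36 + (d - 1) / d * η4 * μ46 + (b - d) / d * η5 * μ56 = 0) ∧
      (-(η2 * μ26) + c / d * η3 * μ36 + (d - c) / d * η4 * μ46 - γ1 / d * η5 * μ56 = 0) ∧
      (a * (c - d) * η1 * lam2 + (d - 1) * η2 * lam1 - μ34 * μ56 + μ36 * μ45 = 0) ∧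
      (γ1 * η1 * lam2 + (b - d) * η2 * lam1 - μ35 * μ46 - μ36 * μ45 = 0) ∧
      (b * (c - d) * η1 * lam3 + (c - 1) * η3 * lam1 - μ24 * μ56 + μ26 * μ45 = 0) ∧
      (γ1 * η1 * lam3 + (a - c) * η3 * lam1 - μ25 * μ46 - μ26 * μ45 = 0) ∧
      (b * c * η1 * lam4 + (b * c - b - c + 1) * η4 * lam1 - μ23 * μ56 + μ26 * μ35 = 0) ∧
      ((a * d - b * c) * η1 * lam4 + γ2 * η4 * lam1 + μ25 * μ36 - μ26 * μ35 = 0) ∧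
      ((d - c) * η1 * lam5 + γ2 * η5 * lam1 - μ24 * μ36 + μ26 * μ34 = 0) ∧
      (c * η1 * lam5 + (a - c) * (1 - b) * η5 * lam1 - μ23 * μ46 - μ26 * μ34 = 0) ∧
      ((b - a) * η1 * lam6 + γ2 * η6 * lam1 + μ24 * μ35 - μ25 * μ34 = 0) ∧
      (a * η1 * lam6 + (c - a) * (d - 1) * η6 * lam1 - μ23 * μ45 + μ25 * μ34 = 0) := by
  -- The coordinates are `μ34, μ35, μ36, μ45, μ46, μ56`. The rescaled `μ j k` with `2 ≤ j < k ≤ 6`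
  -- form a skew-symmetric matrix that kills the all-ones vector, so its five Pfaffians agree up to
  -- sign; `P` is their common value.
  let m34 : MvPolynomial (Fin 6) K := X 0
  let m35 : MvPolynomial (Fin 6) K := X 1
  let m36 : MvPolynomial (Fin 6) K := X 2
  let m45 : MvPolynomial (Fin 6) K := X 3
  let m46 : MvPolynomial (Fin 6) K := X 4
  let m56 : MvPolynomial (Fin 6) K := X 5
  let m23 := -m34 - C a * m35 - C c * m36
  let m24 := m34 - C (a - b) * m45 - C (d - c) * m46
  let m25 := C b⁻¹ * (C a * m35 + C (a - b) * m45 + C γ1 * m56)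
  let m26 := C d⁻¹ * (C c * m36 + C (d - c) * m46 - C γ1 * m56)
  let m12 := -(m24 + m25 + m26)
  let m13 := m34 + m35 + m36
  let m14 := m34 + C (b - 1) * m45 + C (1 - d) * m46
  let m15 := C b⁻¹ * (m35 + C (1 - b) * m45 + C (d - b) * m56)
  let m16 := C d⁻¹ * (m36 + C (d - 1) * m46 + C (b - d) * m56)
  let P := C γ1 * m34 * m56 - C (c * (a - b)) * m36 * m45 - C (a * (c - d)) * m35 * m46
  let l1 := C (-γ3⁻¹) * P
  let l2 := C γ1⁻¹ * (C (-(b - d)) * l1 + m35 * m46 + m36 * m45)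
  let l3 := C γ1⁻¹ * (C (-(a - c)) * l1 + m25 * m46 + m26 * m45)
  let l4 := C γ1⁻¹ * (C (-γ2) * l1 - m25 * m36 + m26 * m35)
  let l5 := C c⁻¹ * (C (-((a - c) * (1 - b))) * l1 + m23 * m46 + m26 * m34)
  let l6 := C a⁻¹ * (C (-((c - a) * (d - 1))) * l1 + m23 * m45 - m25 * m34)
  obtain ⟨x, hx⟩ := exists_forall_mem_eval_ne_zero
    [m12, m13, m14, m15, m16, m23, m24, m25, m26, m34, m35, m36, m45, m46, m56,
      l1, l2, l3, l4, l5, l6] (by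
    simp only [List.forall_mem_cons, m12, m13, m14, m15, m16, m23, m24, m25, m26, m34, m35, m36,
      m45, m46, m56, l1, l2, l3, l4, l5, l6, P, map_add, map_sub, map_mul, map_neg, eval_C, eval_X]
    refine ⟨⟨![1, 0, 0, 0, 0, 0], ?_⟩, ⟨![1, 0, 0, 0, 0, 0], ?_⟩, ⟨![1, 0, 0, 0, 0, 0], ?_⟩,
      ⟨![0, 1, 0, 0, 0, 0], ?_⟩, ⟨![0, 0, 1, 0, 0, 0], ?_⟩, ⟨![1, 0, 0, 0, 0, 0], ?_⟩,
      ⟨![1, 0, 0, 0, 0, 0], ?_⟩, ⟨![0, 1, 0, 0, 0, 0], ?_⟩, ⟨![0, 0, 1, 0, 0, 0], ?_⟩,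
      ⟨![1, 0, 0, 0, 0, 0], ?_⟩, ⟨![0, 1, 0, 0, 0, 0], ?_⟩, ⟨![0, 0, 1, 0, 0, 0], ?_⟩,
      ⟨![0, 0, 0, 1, 0, 0], ?_⟩, ⟨![0, 0, 0, 0, 1, 0], ?_⟩, ⟨![0, 0, 0, 0, 0, 1], ?_⟩,
      ⟨![1, 0, 0, 0, 0, 1], ?_⟩, ⟨![1, 0, 0, 0, 0, 1], ?_⟩, ⟨![1, 0, 0, 0, 0, 1], ?_⟩,
      ⟨![1, 0, 0, 0, 0, 1], ?_⟩, ⟨![0, 0, 1, 1, 0, 0], ?_⟩, ⟨![0, 1, 0, 0, 1, 0], ?_⟩, by simp⟩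
    all_goals simp [sub_eq_zero, ha0, hb0, hc0, hd0, hb1.symm, hd1, hab, hac, hac.symm, hbd.symm,
      hcd, hγ1ne, hγ2ne, hγ3ne])
  simp only [List.forall_mem_cons] at hx
  obtain ⟨h12, h13, h14, h15, h16, h23, h24, h25, h26, h34, h35, h36, h45, h46, h56,
    h1, h2, h3, h4, h5, h6, -⟩ := hx
  refine ⟨1, 1, 1, 1, 1, 1, _, _, _, _, _, _, _, _, _, _, _, _, _, _, _, _, _, _, _, _, _,
    one_ne_zero, one_ne_zero, one_ne_zero, one_ne_zero, one_ne_zero, one_ne_zero,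
    h12, h13, h14, h15, h16, h23, h24, h25, h26, h34, h35, h36, h45, h46, h56,
    h1, h2, h3, h4, h5, h6, ?_⟩
  simp only [m12, m13, m14, m15, m16, m23, m24, m25, m26, m34, m35, m36,
    m45, m46, m56, l1, l2, l3, l4, l5, l6, P, map_add, map_sub, map_mul, map_neg, eval_C, eval_X]
  refine ⟨?_, ?_, ?_, ?_, ?_, ?_, ?_, ?_, ?_, ?_, ?_, ?_, ?_, ?_, ?_, ?_, ?_, ?_, ?_, ?_⟩
  all_goals
    field_simp
    subst hγ1 hγ2 hγ3
    ring
end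

section
/- For r = 6, the number of (−1)-classes is exactly 27: the set {E ∈ ℤ^7 : (E,E) = −1 and (E,K_6) = −1} has exactly 27 elements. -/
/-- The intersection form on `Pic = ℤ^7` with basis `H = e₀`, `E_1,…,E_6`:
`(H,H) = 1`, `(E_i,E_i) = −1`, all other products of distinct basis vectors `0`. -/
def ip (v w : Fin 7 → ℤ) : ℤ := v 0 * w 0 - ∑ i ∈ Finset.univ.erase 0, v i * w i

/-- The canonical class `K_6 = −3H + E_1 + ⋯ + E_6`. -/
def K6 : Fin 7 → ℤ := fun i => if i = 0 then -3 else 1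

/-- A `(−1)`-class: `(E,E) = −1` and `(E,K_6) = −1`. -/
def isClass (E : Fin 7 → ℤ) : Prop := ip E E = -1 ∧ ip E K6 = -1

theorem isClass_iff (E : Fin 7 → ℤ) :
    isClass E ↔ ∑ i : Fin 6, E i.succ ^ 2 = E 0 ^ 2 + 1 ∧ ∑ i : Fin 6, E i.succ = 1 - 3 * E 0 := by
  have h : (Finset.univ.erase 0 : Finset (Fin 7)) = {1, 2, 3, 4, 5, 6} := by decide
  simp only [isClass, ip, K6, h, Fin.sum_univ_six]
  simp
  constructor <;> rintro ⟨h₁, h₂⟩ <;> constructor <;> linarith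

instance (E : Fin 7 → ℤ) : Decidable (isClass E) :=
  decidable_of_iff' _ (isClass_iff E)

/-- The class of degree `d` whose `E_i`-coefficients are supported on `b`, each being `1` if
`d = 0` and `-1` otherwise. -/
def classOf (p : Fin 3 × (Fin 6 → Bool)) : Fin 7 → ℤ :=
  Fin.cons (p.1 : ℤ) fun i => if p.2 i then (if p.1 = 0 then 1 else -1) else 0

theorem classOf_injective : Function.Injective classOf := by
  rintro ⟨d, b⟩ ⟨d', b'⟩ h
  obtain ⟨h₀, h₁⟩ := Fin.cons_inj.mp h
  obtain rfl : d = d' := Fin.ext (by exact_mod_cast h₀)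
  refine Prod.ext rfl (funext fun i => ?_)
  have := congrFun h₁ i
  dsimp only at this ⊢
  rw [Bool.eq_iff_iff]
  by_cases hb : b i = true <;> by_cases hb' : b' i = true <;> by_cases hd : d = 0 <;>
    simp [hb, hb', hd] at this ⊢

theorem isClass.degree_mem {E : Fin 7 → ℤ} (hE : isClass E) : 0 ≤ E 0 ∧ E 0 ≤ 2 := by
  obtain ⟨hq, hl⟩ := (isClass_iff E).mp hE
  have hcs : (∑ i : Fin 6, E i.succ) ^ 2 ≤ 6 * ∑ i : Fin 6, E i.succ ^ 2 := by
    simpa using sq_sum_le_card_mul_sum_sq (s := Finset.univ) (f := fun i : Fin 6 => E i.succ)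
  rw [hq, hl] at hcs
  constructor <;> by_contra! h <;> nlinarith

theorem eq_zero_or_eq_of_sum_mul_sub_eq_zero {ι : Type*} [Fintype ι] {x : ι → ℤ} {ε : ℤ}
    (hε : |ε| ≤ 1) (h : ∑ i, x i * (x i - ε) = 0) (i : ι) : x i = 0 ∨ x i = ε := by
  have hnonneg : ∀ j ∈ Finset.univ, 0 ≤ x j * (x j - ε) := fun j _ => by
    obtain ⟨h₁, h₂⟩ := abs_le.mp hε
    rcases lt_trichotomy (x j) 0 with hx | hx | hx
    · exact mul_nonneg_of_nonpos_of_nonpos hx.le (by lia)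
    · simp [hx]
    · exact mul_nonneg hx.le (by lia)
  rcases mul_eq_zero.mp ((Finset.sum_eq_zero_iff_of_nonneg hnonneg).mp h i (Finset.mem_univ i))
    with h | h
  · exact .inl h
  · exact .inr (sub_eq_zero.mp h)

theorem isClass.mem_range_classOf {E : Fin 7 → ℤ} (hE : isClass E) : E ∈ Set.range classOf := by
  obtain ⟨h₀, h₂⟩ := hE.degree_mem
  obtain ⟨hq, hl⟩ := (isClass_iff E).mp hE
  lift E 0 to ℕ using h₀ with d hd
  have hd3 : d < 3 := by lia
  have hε : |(if d = 0 then 1 else -1 : ℤ)| ≤ 1 := by split_ifs <;> simp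
  have hsum : ∑ i : Fin 6, E i.succ * (E i.succ - if d = 0 then 1 else -1) = 0 := by
    simp only [mul_sub, Finset.sum_sub_distrib, ← Finset.sum_mul, ← sq, hq, hl]
    interval_cases d <;> simp
  have hcoeff := eq_zero_or_eq_of_sum_mul_sub_eq_zero hε hsum
  refine ⟨(⟨d, hd3⟩, fun i => decide (E i.succ ≠ 0)), funext fun i => ?_⟩
  refine Fin.cases ?_ (fun j => ?_) i
  · simp [classOf, hd]
  · rcases hcoeff j with h | h
    · simp [classOf, h]
    · simp only [classOf, Fin.cons_succ, h]
      split_ifs <;> simp_all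

theorem statement12 : {E : Fin 7 → ℤ | isClass E}.ncard = 27 := by
  have h : {E | isClass E} =
      ((Finset.univ.filter fun p => isClass (classOf p)).image classOf : Set (Fin 7 → ℤ)) := by
    ext E
    simp only [Set.mem_ofPred_eq, Finset.coe_image, Finset.coe_filter, Finset.mem_univ, true_and,
      Set.mem_image]
    constructor
    · intro hE
      obtain ⟨p, rfl⟩ := hE.mem_range_classOf
      exact ⟨p, hE, rfl⟩
    · rintro ⟨p, hp, rfl⟩
      exact hp
  rw [h, Set.ncard_coe_finset, Finset.card_image_of_injective _ classOf_injective]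
  decide +kernel
end

section
/- For r = 6: the set of elements D ∈ ℤ^7 with (D,D) = 0 and (D,K_6) = −2 is exactly the set {−K_6 − E : E a (−1)-class}, and hence has exactly 27 elements. Moreover, for each such D, the number of unordered pairs {A, B} of (−1)-classes with A + B = D is exactly 5, and every such pair satisfies (A,B) = 1. -/
/-- The class `a H + ε ∑_{i ∈ s} E_i`. -/
def signedClass (a ε : ℤ) (s : Finset (Fin 6)) : Fin 7 → ℤ :=
  Fin.cons a fun i => if i ∈ s then ε else 0

/-- The 27 lines on a cubic surface: the exceptional curves, the lines through two of the blown-up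
points, and the conics through five of them. -/
def cubicLines : Finset (Fin 7 → ℤ) :=
  (Finset.univ.powersetCard 1).image (signedClass 0 1) ∪
    (Finset.univ.powersetCard 2).image (signedClass 1 (-1)) ∪
    (Finset.univ.powersetCard 5).image (signedClass 2 (-1))

lemma ip_eq (v w : Fin 7 → ℤ) : ip v w = v 0 * w 0 - ∑ i : Fin 6, v i.succ * w i.succ := by
  have h := Finset.add_sum_erase Finset.univ (fun i : Fin 7 => v i * w i) (Finset.mem_univ 0)
  rw [Fin.sum_univ_succ] at h
  simp only [ip]
  linarith

lemma ip_K6 (v : Fin 7 → ℤ) : ip v K6 = -3 * v 0 - ∑ i : Fin 6, v i.succ := by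
  simp [ip_eq, K6, Fin.succ_ne_zero]
  ring

lemma ip_comm (v w : Fin 7 → ℤ) : ip v w = ip w v := by
  simp only [ip, mul_comm]

lemma ip_add_left (u v w : Fin 7 → ℤ) : ip (u + v) w = ip u w + ip v w := by
  simp only [ip, Pi.add_apply, add_mul, Finset.sum_add_distrib]
  ring

lemma ip_neg_left (v w : Fin 7 → ℤ) : ip (-v) w = -ip v w := by
  simp only [ip, Pi.neg_apply, neg_mul, Finset.sum_neg_distrib]
  ring

lemma ip_sub_left (u v w : Fin 7 → ℤ) : ip (u - v) w = ip u w - ip v w := by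
  rw [sub_eq_add_neg, ip_add_left, ip_neg_left, sub_eq_add_neg]

lemma ip_add_right (u v w : Fin 7 → ℤ) : ip u (v + w) = ip u v + ip u w := by
  rw [ip_comm, ip_add_left, ip_comm v, ip_comm w]

lemma ip_sub_right (u v w : Fin 7 → ℤ) : ip u (v - w) = ip u v - ip u w := by
  rw [ip_comm, ip_sub_left, ip_comm v, ip_comm w]

lemma ip_neg_right (u v : Fin 7 → ℤ) : ip u (-v) = -ip u v := by
  rw [ip_comm, ip_neg_left, ip_comm v]

lemma ip_K6_K6 : ip K6 K6 = 3 := by decide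

lemma exists_eq_signedClass {E : Fin 7 → ℤ} {ε : ℤ} {k : ℕ} (hε : ε = 1 ∨ ε = -1)
    (hsum : ∑ i : Fin 6, E i.succ = ε * k) (hsq : ∑ i : Fin 6, E i.succ * E i.succ = k) :
    ∃ s ∈ Finset.univ.powersetCard k, signedClass (E 0) ε s = E := by
  have hε2 : ε * ε = 1 := by rcases hε with rfl | rfl <;> rfl
  have hnonneg : ∀ i ∈ Finset.univ, 0 ≤ E (Fin.succ i) * (E (Fin.succ i) - ε) := by
    intro i _
    rcases hε with rfl | rfl
    · rcases le_or_gt (E (Fin.succ i)) 0 with h | h <;> nlinarith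
    · rcases le_or_gt 0 (E (Fin.succ i)) with h | h <;> nlinarith
  have hzero : ∑ i : Fin 6, E i.succ * (E i.succ - ε) = 0 := by
    simp only [mul_sub, Finset.sum_sub_distrib, ← Finset.sum_mul, hsum, hsq]
    linear_combination (-(k : ℤ)) * hε2
  have hcoord (i : Fin 6) : E i.succ = if E i.succ ≠ 0 then ε else 0 := by
    have h := (Finset.sum_eq_zero_iff_of_nonneg hnonneg).1 hzero i (Finset.mem_univ i)
    rcases mul_eq_zero.1 h with h | h
    · simp [h]
    · split_ifs with h0
      · linarith
      · simpa using h0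
  refine ⟨Finset.univ.filter fun i => E (Fin.succ i) ≠ 0, ?_, ?_⟩
  · rw [Finset.mem_powersetCard]
    refine ⟨Finset.subset_univ _, ?_⟩
    have h : ∑ i : Fin 6, E i.succ = (Finset.univ.filter fun i => E (Fin.succ i) ≠ 0).card * ε := by
      rw [Finset.sum_congr rfl fun i _ => hcoord i, ← Finset.sum_filter, Finset.sum_const,
        nsmul_eq_mul]
    rw [hsum] at h
    have : (k : ℤ) = (Finset.univ.filter fun i => E (Fin.succ i) ≠ 0).card := by
      rcases hε with rfl | rfl <;> linarith
    exact_mod_cast this.symm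
  · funext i
    refine Fin.cases rfl (fun j => ?_) i
    simpa [signedClass] using (hcoord j).symm

lemma isClass_of_mem_cubicLines : ∀ E ∈ cubicLines, ip E E = -1 ∧ ip E K6 = -1 := by
  decide +kernel

lemma isClass_iff_mem_cubicLines {E : Fin 7 → ℤ} : isClass E ↔ E ∈ cubicLines := by
  refine ⟨fun ⟨hE, hK⟩ => ?_, isClass_of_mem_cubicLines E⟩
  rw [ip_eq] at hE
  rw [ip_K6] at hK
  have hsum : ∑ i : Fin 6, E i.succ = 1 - 3 * E 0 := by linarith
  have hsq : ∑ i : Fin 6, E i.succ * E i.succ = E 0 * E 0 + 1 := by linarith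
  have hcs := sq_sum_le_card_mul_sum_sq (s := Finset.univ) (f := fun i : Fin 6 => E i.succ)
  simp only [pow_two, hsum, hsq, Finset.card_univ, Fintype.card_fin] at hcs
  push_cast at hcs
  have hlow : 0 ≤ E 0 := by nlinarith
  have hhigh : E 0 ≤ 2 := by nlinarith
  simp only [cubicLines, Finset.mem_union, Finset.mem_image]
  obtain h | h | h : E 0 = 0 ∨ E 0 = 1 ∨ E 0 = 2 := by omega
  · have := exists_eq_signedClass (E := E) (ε := 1) (k := 1) (by simp) (by simp [hsum, h])
      (by simp [hsq, h])
    rw [h] at this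
    exact .inl (.inl this)
  · have := exists_eq_signedClass (E := E) (ε := -1) (k := 2) (by simp) (by simp [hsum, h])
      (by simp [hsq, h])
    rw [h] at this
    exact .inl (.inr this)
  · have := exists_eq_signedClass (E := E) (ε := -1) (k := 5) (by simp) (by simp [hsum, h])
      (by simp [hsq, h])
    rw [h] at this
    exact .inr this

lemma card_cubicLines : cubicLines.card = 27 := by decide +kernel

lemma isClass_neg_K6_sub_iff {D : Fin 7 → ℤ} :
    isClass (-K6 - D) ↔ ip D D = 0 ∧ ip D K6 = -2 := by
  simp only [isClass, ip_sub_left, ip_sub_right, ip_neg_left, ip_neg_right, ip_K6_K6,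
    ip_comm K6 D]
  omega

lemma isClass_sub_iff {A D : Fin 7 → ℤ} (hA : isClass A) (hD : ip D D = 0)
    (hDK : ip D K6 = -2) : isClass (D - A) ↔ ip A D = 0 := by
  obtain ⟨hAA, hAK⟩ := hA
  simp only [isClass, ip_sub_left, ip_sub_right, ip_comm D A]
  omega

lemma card_pairs_of_mem_cubicLines : ∀ E ∈ cubicLines,
    ((cubicLines.filter fun A => ip A (-K6 - E) = 0).image
      fun A => s(A, -K6 - E - A)).card = 5 := by
  decide +kernel

theorem statement16 :
    ({D : Fin 7 → ℤ | ip D D = 0 ∧ ip D K6 = -2}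
      = {D : Fin 7 → ℤ | ∃ E, isClass E ∧ D = -K6 - E}) ∧
    {D : Fin 7 → ℤ | ip D D = 0 ∧ ip D K6 = -2}.ncard = 27 ∧
    (∀ D : Fin 7 → ℤ, ip D D = 0 → ip D K6 = -2 →
      {p : Sym2 (Fin 7 → ℤ) | ∃ A B : Fin 7 → ℤ,
        p = s(A, B) ∧ isClass A ∧ isClass B ∧ A + B = D}.ncard = 5 ∧
      (∀ A B : Fin 7 → ℤ, isClass A → isClass B → A + B = D → ip A B = 1)) := by
  have hset : {D : Fin 7 → ℤ | ip D D = 0 ∧ ip D K6 = -2}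
      = {D : Fin 7 → ℤ | ∃ E, isClass E ∧ D = -K6 - E} := by
    ext D
    simp only [Set.mem_ofPred_eq, ← isClass_neg_K6_sub_iff]
    constructor
    · exact fun h => ⟨_, h, by abel⟩
    · rintro ⟨E, hE, rfl⟩
      simpa using hE
  refine ⟨hset, ?_, fun D hD hDK => ⟨?_, fun A B hA hB hAB => ?_⟩⟩
  · have himage : {D : Fin 7 → ℤ | ∃ E, isClass E ∧ D = -K6 - E}
        = (fun E => -K6 - E) '' (cubicLines : Set (Fin 7 → ℤ)) := by
      ext D
      simp [isClass_iff_mem_cubicLines, eq_comm]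
    rw [hset, himage, Set.ncard_image_of_injective _ sub_right_injective, Set.ncard_coe_finset,
      card_cubicLines]
  · have hcard := card_pairs_of_mem_cubicLines (-K6 - D)
      (isClass_iff_mem_cubicLines.1 (isClass_neg_K6_sub_iff.2 ⟨hD, hDK⟩))
    rw [sub_sub_cancel] at hcard
    rw [← hcard, ← Set.ncard_coe_finset]
    congr 1
    ext p
    simp only [Set.mem_ofPred_eq, Finset.coe_image, Finset.coe_filter, Set.mem_image,
      ← isClass_iff_mem_cubicLines]
    constructor
    · rintro ⟨A, B, rfl, hA, hB, rfl⟩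
      refine ⟨A, ⟨hA, (isClass_sub_iff hA hD hDK).1 ?_⟩, ?_⟩ <;> simp [hB]
    · rintro ⟨A, ⟨hA, hAD⟩, rfl⟩
      exact ⟨A, D - A, rfl, hA, (isClass_sub_iff hA hD hDK).2 hAD, by abel⟩
  · subst hAB
    simp only [ip_add_left, ip_add_right, hA.1, hB.1, ip_comm B A] at hD
    omega
end
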